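/- For any NOR circuit C with n inputs and m gates, there exist a matrix B with entries in {−1, 0, +1} and an integer vector c such that: (1) the map sending a 0-1 solution y of the system By = 1 (all right-hand sides equal to 1) to its first n coordinates (y_1, …, y_n) is a bijection from the set of 0-1 solutions of By = 1 onto {0,1}^n; and (2) for every 0-1 solution y of By = 1, one has c·y > 0 if and only if C(y_1, …, y_n) = 1. -/

import Mathlib

/-- Wire values of a NOR circuit with `n` inputs and `m` NOR gates: wire `j < n`
is input `j`; wire `n + k` (for `k < m`) is the NOR of the two earlier wires
`(g k).1` and `(g k).2`; the circuit output is wire `n + m - 1` (the last gate). -/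
def norWires (n m : ℕ) (g : (k : Fin m) → Fin (n + k.1) × Fin (n + k.1))
    (x : Fin n → Bool) : ℕ → Bool
  | j =>
    if hj : j < n then x ⟨j, hj⟩
    else if hk : j - n < m then
      have := (g ⟨j - n, hk⟩).1.isLt
      have := (g ⟨j - n, hk⟩).2.isLt
      !(norWires n m g x ((g ⟨j - n, hk⟩).1 : ℕ)
        || norWires n m g x ((g ⟨j - n, hk⟩).2 : ℕ))
    else false
termination_by j => j
decreasing_by
  · omega
  · omega

section helpers

theorem norWires_input (n m : ℕ) (g : (k : Fin m) → Fin (n + k.1) × Fin (n + k.1))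
    (x : Fin n → Bool) (j : ℕ) (hj : j < n) : norWires n m g x j = x ⟨j, hj⟩ := by
  rw [norWires]; simp [hj]

theorem norWires_gate (n m : ℕ) (g : (k : Fin m) → Fin (n + k.1) × Fin (n + k.1))
    (x : Fin n → Bool) (k : Fin m) : norWires n m g x (n + k.1) =
      !(norWires n m g x ((g k).1 : ℕ) || norWires n m g x ((g k).2 : ℕ)) := by
  rw [norWires]
  have h1 : ¬ (n + k.1 < n) := by omega
  have h2 : n + k.1 - n < m := by omega
  have h3 : (⟨n + k.1 - n, h2⟩ : Fin m) = k := by ext; simp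
  rw [dif_neg h1, dif_pos h2]
  have h4 : ∀ k' : Fin m, k' = k →
      (!(norWires n m g x ((g k').1 : ℕ) || norWires n m g x ((g k').2 : ℕ))) =
      !(norWires n m g x ((g k).1 : ℕ) || norWires n m g x ((g k).2 : ℕ)) := by
    rintro k' rfl
    rfl
  exact h4 _ h3

/-- wire index. -/
def wI (n m : ℕ) (j : ℕ) (hj : j < n + m) : Fin (n + m + m + m) := ⟨j, by omega⟩

/-- output of gate `k`. -/
def zI (n m : ℕ) (k : Fin m) : Fin (n + m + m + m) := ⟨n + k.1, by omega⟩

/-- first auxiliary variable of gate `k`. -/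
def pI (n m : ℕ) (k : Fin m) : Fin (n + m + m + m) := ⟨n + m + k.1, by omega⟩

/-- second auxiliary variable of gate `k`. -/
def tI (n m : ℕ) (k : Fin m) : Fin (n + m + m + m) := ⟨n + m + m + k.1, by omega⟩

/-- first operand. -/
def aI (n m : ℕ) (g : (k : Fin m) → Fin (n + k.1) × Fin (n + k.1)) (k : Fin m) :
    Fin (n + m + m + m) := ⟨(g k).1, by omega⟩

/-- second operand. -/
def bI (n m : ℕ) (g : (k : Fin m) → Fin (n + k.1) × Fin (n + k.1)) (k : Fin m) :
    Fin (n + m + m + m) := ⟨(g k).2, by omega⟩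

/-- rows of the first kind. -/
def row1 (n m : ℕ) (g : (k : Fin m) → Fin (n + k.1) × Fin (n + k.1)) (k : Fin m)
    (i : Fin (n + m + m + m)) : ℤ :=
  if i = aI n m g k ∨ i = bI n m g k ∨ i = zI n m k then 1
  else if i = pI n m k then -1 else 0

/-- rows of the second kind. -/
def row2 (n m : ℕ) (k : Fin m) (i : Fin (n + m + m + m)) : ℤ :=
  if i = zI n m k ∨ i = pI n m k ∨ i = tI n m k then 1 else 0

theorem row1_sum (n m : ℕ) (g : (k : Fin m) → Fin (n + k.1) × Fin (n + k.1)) (k : Fin m)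
    (y : Fin (n + m + m + m) → ℤ) : ∑ i, row1 n m g k i * y i =
      y (aI n m g k) + (if aI n m g k = bI n m g k then 0 else y (bI n m g k))
        + y (zI n m k) - y (pI n m k) := by
  have ha := (g k).1.isLt
  have hb := (g k).2.isLt
  have hk := k.isLt
  have key : ∀ i, row1 n m g k i * y i =
      (if i = aI n m g k then y i else 0)
      + (if i = bI n m g k then (if aI n m g k = bI n m g k then 0 else y i) else 0)
      + (if i = zI n m k then y i else 0) - (if i = pI n m k then y i else 0) := by
    intro i
    have h1 : aI n m g k ≠ zI n m k := by simp only [aI, zI, ne_eq, Fin.mk.injEq]; omega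
    have h2 : bI n m g k ≠ zI n m k := by simp only [bI, zI, ne_eq, Fin.mk.injEq]; omega
    have h3 : aI n m g k ≠ pI n m k := by simp only [aI, pI, ne_eq, Fin.mk.injEq]; omega
    have h4 : bI n m g k ≠ pI n m k := by simp only [bI, pI, ne_eq, Fin.mk.injEq]; omega
    have h5 : zI n m k ≠ pI n m k := by simp only [zI, pI, ne_eq, Fin.mk.injEq]; omega
    unfold row1
    grind
  rw [Finset.sum_congr rfl (fun i _ => key i)]
  simp [Finset.sum_add_distrib, Finset.sum_sub_distrib]

theorem row2_sum (n m : ℕ) (k : Fin m)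
    (y : Fin (n + m + m + m) → ℤ) : ∑ i, row2 n m k i * y i =
      y (zI n m k) + y (pI n m k) + y (tI n m k) := by
  have hk := k.isLt
  have key : ∀ i, row2 n m k i * y i =
      (if i = zI n m k then y i else 0) + (if i = pI n m k then y i else 0)
      + (if i = tI n m k then y i else 0) := by
    intro i
    have h1 : zI n m k ≠ tI n m k := by simp only [tI, zI, ne_eq, Fin.mk.injEq]; omega
    have h2 : pI n m k ≠ tI n m k := by simp only [pI, tI, ne_eq, Fin.mk.injEq]; omega
    have h5 : zI n m k ≠ pI n m k := by simp only [zI, pI, ne_eq, Fin.mk.injEq]; omega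
    unfold row2
    grind
  rw [Finset.sum_congr rfl (fun i _ => key i)]
  simp [Finset.sum_add_distrib]

/-- the matrix. -/
def matB (n m : ℕ) (g : (k : Fin m) → Fin (n + k.1) × Fin (n + k.1)) (r : Fin (m + m)) :
    Fin (n + m + m + m) → ℤ :=
  Fin.addCases (motive := fun _ => Fin (n + m + m + m) → ℤ)
    (fun k => row1 n m g k) (fun k => row2 n m k) r

theorem matB_iff (n m : ℕ) (g : (k : Fin m) → Fin (n + k.1) × Fin (n + k.1))
    (y : Fin (n + m + m + m) → ℤ) :
    (∀ r, ∑ i, matB n m g r i * y i = 1) ↔ ∀ k : Fin m,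
      (y (aI n m g k) + (if aI n m g k = bI n m g k then 0 else y (bI n m g k))
        + y (zI n m k) - y (pI n m k) = 1) ∧
      (y (zI n m k) + y (pI n m k) + y (tI n m k) = 1) := by
  constructor
  · intro h k
    have h1 := h (Fin.castAdd m k)
    have h2 := h (Fin.natAdd m k)
    simp only [matB, Fin.addCases_left, Fin.addCases_right, row1_sum, row2_sum] at h1 h2
    exact ⟨h1, h2⟩
  · intro h r
    refine Fin.addCases (fun k => ?_) (fun k => ?_) r
    · simp only [matB, Fin.addCases_left, row1_sum]; exact (h k).1
    · simp only [matB, Fin.addCases_right, row2_sum]; exact (h k).2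

theorem wires_eq (n m : ℕ) (g : (k : Fin m) → Fin (n + k.1) × Fin (n + k.1))
    (hN : n ≤ n + m + m + m)
    (y : Fin (n + m + m + m) → ℤ) (h01 : ∀ i, y i = 0 ∨ y i = 1)
    (h : ∀ r, ∑ i, matB n m g r i * y i = 1) (j : ℕ) (hj : j < n + m) :
    y (wI n m j hj) = if norWires n m g
      (fun j : Fin n => decide (y (Fin.castLE hN j) = 1)) j = true then 1 else 0 := by
  rw [matB_iff] at h
  induction j using Nat.strong_induction_on with
  | _ j ih =>
    by_cases hn : j < n
    · rw [norWires_input _ _ _ _ _ hn]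
      have : wI n m j hj = Fin.castLE hN ⟨j, hn⟩ := rfl
      rw [this]
      rcases h01 (Fin.castLE hN ⟨j, hn⟩) with h0 | h0 <;> simp only [h0] <;> decide
    · obtain ⟨k, rfl⟩ : ∃ k : Fin m, j = n + k.1 :=
        ⟨⟨j - n, by omega⟩, by simp only; omega⟩
      rw [norWires_gate]
      have ea := ih (g k).1 (g k).1.isLt (by omega)
      have eb := ih (g k).2 (g k).2.isLt (by omega)
      have e1 : wI n m (g k).1 (by omega) = aI n m g k := rfl
      have e2 : wI n m (g k).2 (by omega) = bI n m g k := rfl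
      have e3 : wI n m (n + k.1) hj = zI n m k := rfl
      rw [e1] at ea
      rw [e2] at eb
      rw [e3]
      obtain ⟨h1, h2⟩ := h k
      have hz := h01 (zI n m k)
      have hp := h01 (pI n m k)
      have ht := h01 (tI n m k)
      cases hA : norWires n m g (fun j : Fin n => decide (y (Fin.castLE hN j) = 1)) (g k).1 <;>
      cases hB : norWires n m g (fun j : Fin n => decide (y (Fin.castLE hN j) = 1)) (g k).2 <;>
      simp only [hA, hB] at ea eb <;> by_cases hab : aI n m g k = bI n m g k <;>
      simp [hab] at * <;> omega

/-- the solution attached to wire values `v`. -/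
def sol (n m : ℕ) (g : (k : Fin m) → Fin (n + k.1) × Fin (n + k.1)) (v : ℕ → Bool)
    (i : Fin (n + m + m + m)) : ℤ :=
  if i.1 < n + m then (if v i.1 then 1 else 0)
  else if h : i.1 - (n + m) < m then
    (if (v (g ⟨i.1 - (n + m), h⟩).1 && v (g ⟨i.1 - (n + m), h⟩).2) = true ∧
      (g ⟨i.1 - (n + m), h⟩).1 ≠ (g ⟨i.1 - (n + m), h⟩).2 then 1 else 0)
  else if h : i.1 - (n + m + m) < m then
    (if (v (g ⟨i.1 - (n + m + m), h⟩).1 || v (g ⟨i.1 - (n + m + m), h⟩).2) = true ∧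
      ¬ ((v (g ⟨i.1 - (n + m + m), h⟩).1 && v (g ⟨i.1 - (n + m + m), h⟩).2) = true ∧
      (g ⟨i.1 - (n + m + m), h⟩).1 ≠ (g ⟨i.1 - (n + m + m), h⟩).2) then 1 else 0)
  else 0

theorem sol_p (n m : ℕ) (g : (k : Fin m) → Fin (n + k.1) × Fin (n + k.1)) (v : ℕ → Bool)
    (k : Fin m) : sol n m g v (pI n m k) =
      if (v (g k).1 && v (g k).2) = true ∧ (g k).1 ≠ (g k).2 then 1 else 0 := by
  have h1 : ¬ ((pI n m k).1 < n + m) := by simp [pI]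
  have h2 : (pI n m k).1 - (n + m) < m := by simp [pI]
  have h3 : (⟨(pI n m k).1 - (n + m), h2⟩ : Fin m) = k := by ext; simp [pI]
  unfold sol
  rw [if_neg h1, dif_pos h2, h3]

theorem sol_t (n m : ℕ) (g : (k : Fin m) → Fin (n + k.1) × Fin (n + k.1)) (v : ℕ → Bool)
    (k : Fin m) : sol n m g v (tI n m k) =
      if (v (g k).1 || v (g k).2) = true ∧
      ¬ ((v (g k).1 && v (g k).2) = true ∧ (g k).1 ≠ (g k).2) then 1 else 0 := by
  have h1 : ¬ ((tI n m k).1 < n + m) := by simp only [tI]; omega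
  have h1' : ¬ ((tI n m k).1 - (n + m) < m) := by simp only [tI]; omega
  have h2 : (tI n m k).1 - (n + m + m) < m := by simp [tI]
  have h3 : (⟨(tI n m k).1 - (n + m + m), h2⟩ : Fin m) = k := by ext; simp [tI]
  unfold sol
  rw [if_neg h1, dif_neg h1', dif_pos h2, h3]

theorem sol_w (n m : ℕ) (g : (k : Fin m) → Fin (n + k.1) × Fin (n + k.1)) (v : ℕ → Bool)
    (i : Fin (n + m + m + m)) (h : i.1 < n + m) : sol n m g v i = if v i.1 then 1 else 0 := by
  unfold sol
  rw [if_pos h]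

theorem sol_01 (n m : ℕ) (g : (k : Fin m) → Fin (n + k.1) × Fin (n + k.1)) (v : ℕ → Bool)
    (i : Fin (n + m + m + m)) : sol n m g v i = 0 ∨ sol n m g v i = 1 := by
  unfold sol
  split_ifs <;> simp

theorem sol_sat (n m : ℕ) (g : (k : Fin m) → Fin (n + k.1) × Fin (n + k.1)) (v : ℕ → Bool)
    (hv : ∀ k : Fin m, v (n + k.1) = !(v (g k).1 || v (g k).2)) (r : Fin (m + m)) :
    ∑ i, matB n m g r i * sol n m g v i = 1 := by
  revert r
  rw [matB_iff]
  intro k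
  have ha := (g k).1.isLt
  have hb := (g k).2.isLt
  have hk := k.isLt
  rw [sol_p, sol_t, sol_w n m g v (aI n m g k) (by simp only [aI]; omega),
    sol_w n m g v (bI n m g k) (by simp only [bI]; omega),
    sol_w n m g v (zI n m k) (by simp only [zI]; omega)]
  have e : (aI n m g k = bI n m g k) ↔ (g k).1 = (g k).2 := by
    simp [aI, bI, Fin.ext_iff]
  simp only [e]
  have hz : v (zI n m k).1 = !(v (g k).1 || v (g k).2) := hv k
  have h1 : v (aI n m g k).1 = v (g k).1 := rfl
  have h2 : v (bI n m g k).1 = v (g k).2 := rfl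
  rw [hz, h1, h2]
  by_cases hab : (g k).1 = (g k).2
  · rw [hab]; cases v (g k).2 <;> simp
  · cases v (g k).1 <;> cases v (g k).2 <;> simp [hab]

theorem idx_cases (n m : ℕ) (i : Fin (n + m + m + m)) :
    (∃ h : i.1 < n + m, i = wI n m i.1 h) ∨ (∃ k, i = pI n m k) ∨ (∃ k, i = tI n m k) := by
  by_cases h : i.1 < n + m
  · exact Or.inl ⟨h, rfl⟩
  by_cases h2 : i.1 < n + m + m
  · exact Or.inr (Or.inl ⟨⟨i.1 - (n + m), by omega⟩, by ext; simp only [pI]; omega⟩)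
  · exact Or.inr (Or.inr ⟨⟨i.1 - (n + m + m), by omega⟩, by ext; simp only [tI]; omega⟩)

end helpers

/-- circuit to equations.
For any NOR circuit `C` with `n` inputs and `m ≥ 1` gates there exist a matrix
`B` with entries in `{-1,0,1}` and an integer vector `c` such that: (1) mapping
a 0-1 solution `y` of `B y = 1` to its first `n` coordinates is a bijection
from the 0-1 solutions of `B y = 1` onto `{0,1}^n`; and (2) for every 0-1
solution `y` of `B y = 1`, `c·y > 0` iff `C(y₁,…,yₙ) = 1`. -/
theorem stmt_13 (n m : ℕ) (hm : 1 ≤ m)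
    (g : (k : Fin m) → Fin (n + k.1) × Fin (n + k.1)) :
    ∃ (q N : ℕ) (hN : n ≤ N) (B : Fin q → Fin N → ℤ) (c : Fin N → ℤ),
      (∀ r i, B r i ∈ ({-1, 0, 1} : Set ℤ)) ∧
      Set.BijOn (fun y : Fin N → ℤ => fun j : Fin n => y (Fin.castLE hN j))
        {y | (∀ i, y i ∈ ({0, 1} : Set ℤ)) ∧ ∀ r, ∑ i, B r i * y i = 1}
        {x : Fin n → ℤ | ∀ j, x j ∈ ({0, 1} : Set ℤ)} ∧
      (∀ y : Fin N → ℤ, (∀ i, y i ∈ ({0, 1} : Set ℤ)) →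
        (∀ r, ∑ i, B r i * y i = 1) →
        ((0 < ∑ i, c i * y i) ↔
          norWires n m g
            (fun j : Fin n => decide (y (Fin.castLE hN j) = 1))
            (n + m - 1) = true)) := by
  have hN : n ≤ n + m + m + m := by omega
  refine ⟨m + m, n + m + m + m, hN, matB n m g,
    fun i => if i = wI n m (n + m - 1) (by omega) then 1 else 0, ?_, ⟨?_, ?_, ?_⟩, ?_⟩
  · intro r i
    refine Fin.addCases (fun k => ?_) (fun k => ?_) r
    · simp only [matB, Fin.addCases_left, row1]; split_ifs <;> simp
    · simp only [matB, Fin.addCases_right, row2]; split_ifs <;> simp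
  · intro y hy j
    exact hy.1 _
  · rintro y ⟨hy, hy'⟩ z ⟨hz, hz'⟩ hyz
    have hyz' : ∀ j : Fin n, y (Fin.castLE hN j) = z (Fin.castLE hN j) := fun j => congrFun hyz j
    have wy := wires_eq n m g hN y hy hy'
    have wz := wires_eq n m g hN z hz hz'
    have hw : ∀ j hj, y (wI n m j hj) = z (wI n m j hj) := by
      intro j hj
      rw [wy, wz]
      simp only [hyz']
    rw [matB_iff] at hy' hz'
    have hp : ∀ k, y (pI n m k) = z (pI n m k) := by
      intro k
      have h1 := (hy' k).1
      have h2 := (hz' k).1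
      have ea : y (aI n m g k) = z (aI n m g k) := hw (g k).1 (by omega)
      have eb : y (bI n m g k) = z (bI n m g k) := hw (g k).2 (by omega)
      have ez : y (zI n m k) = z (zI n m k) := hw (n + k.1) (by omega)
      rw [ea, eb, ez] at h1
      linarith
    have ht : ∀ k, y (tI n m k) = z (tI n m k) := by
      intro k
      have h1 := (hy' k).2
      have h2 := (hz' k).2
      have ez : y (zI n m k) = z (zI n m k) := hw (n + k.1) (by omega)
      have ep := hp k
      linarith
    funext i
    rcases idx_cases n m i with ⟨h, e⟩ | ⟨k, e⟩ | ⟨k, e⟩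
    · rw [e]; exact hw _ _
    · rw [e]; exact hp k
    · rw [e]; exact ht k
  · intro x hx
    refine ⟨sol n m g (norWires n m g (fun j => decide (x j = 1))),
      ⟨fun i => sol_01 n m g _ i, sol_sat n m g _ (norWires_gate n m g _)⟩, ?_⟩
    funext j
    have hj := j.isLt
    simp only
    rw [sol_w _ _ _ _ _ (by simp only [Fin.val_castLE]; omega), Fin.val_castLE,
      norWires_input _ _ _ _ _ hj]
    rcases hx j with h | h
    · simp [h]
    · have h : x j = 1 := h
      simp [h]
  · intro y hy hy'
    have := wires_eq n m g hN y hy hy' (n + m - 1) (by omega)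
    simp only [ite_mul, one_mul, zero_mul, Finset.sum_ite_eq', Finset.mem_univ, if_true]
    rw [this]
    split_ifs with h <;> simp [h]
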